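/- arXiv:1912.00160 — 2 statements merged into one kernel-verified Lean document; each statement's English description precedes it below -/
import Mathlib

section
/- Let μ be a probability measure on [0, ∞) with finite moments m_n = ∫ x^n dμ(x) < ∞ for all n ≥ 0, and suppose the moments follow a quadratic rate of growth: there exists a constant C > 0 such that m_{n+1} ≤ C (n+1)^2 m_n for all n ≥ 0. Then μ is moment determinate: any probability measure ν on [0, ∞) satisfying ∫ x^n dν(x) = m_n for all n ≥ 1 equals μ. -/
open MeasureTheory Filter Topology

lemma qg_ext_of_moments (σ τ : Measure ℝ) [IsFiniteMeasure σ] [IsFiniteMeasure τ]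
    (hσ : (0:ℝ) ∈ interior (ProbabilityTheory.integrableExpSet id σ))
    (hτ : (0:ℝ) ∈ interior (ProbabilityTheory.integrableExpSet id τ))
    (h : ∀ n : ℕ, ∫ x, x ^ n ∂σ = ∫ x, x ^ n ∂τ) : σ = τ := by
  have key : ∀ ρ : Measure ℝ, (0:ℝ) ∈ interior (ProbabilityTheory.integrableExpSet id ρ) →
      ∀ n : ℕ, iteratedDeriv n (ProbabilityTheory.complexMGF id ρ) 0
        = ((∫ x, x ^ n ∂ρ : ℝ) : ℂ) := by
    intro ρ hρ n
    rw [ProbabilityTheory.iteratedDeriv_complexMGF (by simpa using hρ), ← integral_complex_ofReal]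
    simp
  have ha := (ProbabilityTheory.analyticAt_complexMGF (X := id) (μ := σ) (z := 0)
    (by simpa using hσ)).hasFPowerSeriesAt
  have hb := (ProbabilityTheory.analyticAt_complexMGF (X := id) (μ := τ) (z := 0)
    (by simpa using hτ)).hasFPowerSeriesAt
  have hev : ProbabilityTheory.complexMGF id σ =ᶠ[𝓝 0] ProbabilityTheory.complexMGF id τ := by
    have hs : (fun n ↦ iteratedDeriv n (ProbabilityTheory.complexMGF id σ) 0 / (n.factorial : ℂ))
        = (fun n ↦ iteratedDeriv n (ProbabilityTheory.complexMGF id τ) 0 / (n.factorial : ℂ)) := by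
      funext n
      rw [key σ hσ, key τ hτ, h]
    rw [hs] at ha
    obtain ⟨r, hr⟩ := ha
    obtain ⟨r', hr'⟩ := hb
    filter_upwards [hr.eventually_hasSum_sub, hr'.eventually_hasSum_sub] with z h1 h2
    exact h1.unique h2
  set U : Set ℂ := {z | z.re ∈ interior (ProbabilityTheory.integrableExpSet id σ) ∩
    interior (ProbabilityTheory.integrableExpSet id τ)} with hU
  have hpre : IsPreconnected U :=
    ((ProbabilityTheory.convex_integrableExpSet.interior.inter
      ProbabilityTheory.convex_integrableExpSet.interior).linear_preimage
        Complex.reLm).isPreconnected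
  have heq : Set.EqOn (ProbabilityTheory.complexMGF id σ) (ProbabilityTheory.complexMGF id τ) U :=
    AnalyticOnNhd.eqOn_of_preconnected_of_eventuallyEq
      (fun z hz => ProbabilityTheory.analyticAt_complexMGF hz.1)
      (fun z hz => ProbabilityTheory.analyticAt_complexMGF hz.2) hpre
      (z₀ := 0) (by simp [hU, hσ, hτ]) hev
  apply Measure.ext_of_charFun
  funext t
  rw [← ProbabilityTheory.complexMGF_id_mul_I, ← ProbabilityTheory.complexMGF_id_mul_I]
  exact heq (by simp [hU, hσ, hτ])

lemma qg_integrable_cosh (μ : Measure ℝ) (hμsupp : μ (Set.Iio 0) = 0)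
    (hint : ∀ n : ℕ, Integrable (fun x : ℝ => x ^ n) μ) (C : ℝ) (hC : 0 < C)
    (hb : ∀ n : ℕ, ∫ x, x ^ n ∂μ ≤ C ^ n * (n.factorial : ℝ) ^ 2) (t : ℝ)
    (ht : t ^ 2 * C ≤ 1 / 4) :
    Integrable (fun x : ℝ => Real.cosh (t * √x)) μ := by
  have hpos : ∀ᵐ x ∂μ, 0 ≤ x := by
    rw [ae_iff]; simpa [Set.Iio] using hμsupp
  refine ⟨by fun_prop, ?_⟩
  rw [hasFiniteIntegral_iff_ofReal (ae_of_all _ fun x => (Real.cosh_pos _).le)]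
  have h1 : ∫⁻ x, ENNReal.ofReal (Real.cosh (t * √x)) ∂μ
      = ∫⁻ x, ∑' n : ℕ, ENNReal.ofReal ((t ^ 2) ^ n / ((2 * n).factorial : ℝ) * x ^ n) ∂μ := by
    refine lintegral_congr_ae ?_
    filter_upwards [hpos] with x hx
    have hs := Real.hasSum_cosh (t * √x)
    have he : (fun n : ℕ => (t * √x) ^ (2 * n) / ((2 * n).factorial : ℝ))
        = fun n : ℕ => (t ^ 2) ^ n / ((2 * n).factorial : ℝ) * x ^ n := by
      funext n
      rw [pow_mul, mul_pow, Real.sq_sqrt hx, mul_pow]; ring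
    rw [he] at hs
    rw [← hs.tsum_eq, ENNReal.ofReal_tsum_of_nonneg (fun n => by positivity) hs.summable]
  rw [h1, lintegral_tsum (fun n => by fun_prop)]
  have h2 : ∀ n : ℕ, ∫⁻ x, ENNReal.ofReal ((t ^ 2) ^ n / ((2 * n).factorial : ℝ) * x ^ n) ∂μ
      ≤ ENNReal.ofReal ((1 / 4 : ℝ) ^ n) := by
    intro n
    rw [← ofReal_integral_eq_lintegral_ofReal ((hint n).const_mul _)
      (by filter_upwards [hpos] with x hx; simp only [Pi.zero_apply]; positivity)]
    apply ENNReal.ofReal_le_ofReal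
    rw [integral_const_mul]
    have hf : ((n.factorial : ℝ)) ^ 2 ≤ ((2 * n).factorial : ℝ) := by
      have := Nat.le_of_dvd (Nat.factorial_pos _) (Nat.factorial_mul_factorial_dvd_factorial_add n n)
      rw [two_mul, sq]; exact_mod_cast this
    have hF : (0:ℝ) < ((2 * n).factorial : ℝ) := by positivity
    calc (t ^ 2) ^ n / ((2 * n).factorial : ℝ) * ∫ x, x ^ n ∂μ
        ≤ (t ^ 2) ^ n / ((2 * n).factorial : ℝ) * (C ^ n * ((2 * n).factorial : ℝ)) := by
          refine mul_le_mul_of_nonneg_left ((hb n).trans ?_) (by positivity)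
          gcongr
      _ = (t ^ 2 * C) ^ n := by rw [mul_pow]; field_simp
      _ ≤ (1 / 4) ^ n := by gcongr
  refine (ENNReal.tsum_le_tsum h2).trans_lt ?_
  rw [← ENNReal.ofReal_tsum_of_nonneg (fun n => by positivity)
    (summable_geometric_of_lt_one (by norm_num) (by norm_num))]
  exact ENNReal.ofReal_lt_top

/-- The symmetrized square root of a measure. -/
noncomputable def qgSym (μ : Measure ℝ) : Measure ℝ :=
  μ.map (fun x => √x) + μ.map (fun x => -√x)

instance (μ : Measure ℝ) [IsFiniteMeasure μ] : IsFiniteMeasure (qgSym μ) := by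
  unfold qgSym; infer_instance

lemma qgSym_zero_mem (μ : Measure ℝ) (t : ℝ) (ht : 0 < t)
    (h : Integrable (fun x : ℝ => Real.cosh (t * √x)) μ) :
    (0:ℝ) ∈ interior (ProbabilityTheory.integrableExpSet id (qgSym μ)) := by
  refine mem_interior.2 ⟨Set.Ioo (-t) t, ?_, isOpen_Ioo, by simp [ht]⟩
  intro s hs
  have hle : ∀ x : ℝ, Real.exp (s * √x) ≤ 2 * Real.cosh (t * √x) ∧
      Real.exp (s * -√x) ≤ 2 * Real.cosh (t * √x) := by
    intro x
    have hx := Real.sqrt_nonneg x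
    have e0 := Real.exp_pos (-(t * √x))
    have e1 : Real.exp (s * √x) ≤ Real.exp (t * √x) :=
      Real.exp_le_exp.2 (by nlinarith [hs.2])
    have e2 : Real.exp (s * -√x) ≤ Real.exp (t * √x) :=
      Real.exp_le_exp.2 (by nlinarith [hs.1])
    rw [Real.cosh_eq]
    constructor <;> linarith
  change Integrable (fun x : ℝ => Real.exp (s * id x)) (qgSym μ)
  rw [qgSym, integrable_add_measure, integrable_map_measure (by fun_prop) (by fun_prop),
    integrable_map_measure (by fun_prop) (by fun_prop)]
  constructor
  · refine (h.const_mul 2).mono' (by fun_prop) (ae_of_all _ fun x => ?_)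
    simpa [abs_of_pos (Real.exp_pos _)] using (hle x).1
  · refine (h.const_mul 2).mono' (by fun_prop) (ae_of_all _ fun x => ?_)
    simpa [abs_of_pos (Real.exp_pos _)] using (hle x).2

lemma qgSym_moment (μ : Measure ℝ) (hμsupp : μ (Set.Iio 0) = 0)
    (h : (0:ℝ) ∈ interior (ProbabilityTheory.integrableExpSet id (qgSym μ))) (n : ℕ) :
    ∫ x, x ^ n ∂(qgSym μ) = if Even n then 2 * ∫ x, x ^ (n / 2) ∂μ else 0 := by
  have hpos : ∀ᵐ x ∂μ, 0 ≤ x := by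
    rw [ae_iff]; simpa [Set.Iio] using hμsupp
  have hi : Integrable (fun x : ℝ => x ^ n) (qgSym μ) := by
    have := ProbabilityTheory.integrable_pow_of_mem_interior_integrableExpSet h n
    simpa using this
  rw [qgSym, integrable_add_measure] at hi
  rw [qgSym, integral_add_measure hi.1 hi.2, integral_map (by fun_prop) (by fun_prop),
    integral_map (by fun_prop) (by fun_prop)]
  split_ifs with he
  · obtain ⟨k, rfl⟩ := he
    have hk : (k + k) / 2 = k := by omega
    rw [hk, two_mul]
    congr 1 <;>
    · refine integral_congr_ae ?_
      filter_upwards [hpos] with x hx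
      rw [← two_mul, pow_mul]
      simp [Real.sq_sqrt hx]
  · have ho := Nat.not_even_iff_odd.1 he
    simp [ho.neg_pow, integral_neg]

lemma qgSym_map (μ : Measure ℝ) (hμsupp : μ (Set.Iio 0) = 0) :
    (qgSym μ).map (fun x => x ^ 2) = μ + μ := by
  have hpos : ∀ᵐ x ∂μ, 0 ≤ x := by
    rw [ae_iff]; simpa [Set.Iio] using hμsupp
  rw [qgSym, Measure.map_add _ _ (by fun_prop), Measure.map_map (by fun_prop) (by fun_prop),
    Measure.map_map (by fun_prop) (by fun_prop)]
  congr 1 <;>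
  · conv_rhs => rw [← Measure.map_id (μ := μ)]
    refine Measure.map_congr ?_
    filter_upwards [hpos] with x hx
    simp [Real.sq_sqrt hx]

/-- **Quadratic moment growth implies determinacy (Stieltjes case).** If a probability
measure `μ` on `[0, ∞)` has finite moments `m n = ∫ x ^ n ∂μ` for all `n ≥ 0` and there
is a constant `C > 0` with `m (n+1) ≤ C * (n+1)^2 * m n` for all `n ≥ 0`, then `μ` is
moment determinate. -/
theorem quadratic_growth_determinate
    (μ : Measure ℝ) [IsProbabilityMeasure μ] (hμsupp : μ (Set.Iio 0) = 0)
    (m : ℕ → ℝ)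
    (hint : ∀ n : ℕ, Integrable (fun x : ℝ => x ^ n) μ)
    (hm : ∀ n : ℕ, m n = ∫ x, x ^ n ∂μ)
    (hgrowth : ∃ C : ℝ, 0 < C ∧ ∀ n : ℕ, m (n + 1) ≤ C * (n + 1) ^ 2 * m n) :
    ∀ ν : Measure ℝ, IsProbabilityMeasure ν → ν (Set.Iio 0) = 0 →
      (∀ n : ℕ, 1 ≤ n → Integrable (fun x : ℝ => x ^ n) ν) →
      (∀ n : ℕ, 1 ≤ n → ∫ x, x ^ n ∂ν = m n) →
      ν = μ := by
  intro ν hν hνsupp hνint hνm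
  obtain ⟨C, hC, hg⟩ := hgrowth
  have hνint' : ∀ n : ℕ, Integrable (fun x : ℝ => x ^ n) ν := by
    intro n
    rcases Nat.eq_zero_or_pos n with rfl | hn
    · simp
    · exact hνint n hn
  have heq : ∀ n : ℕ, ∫ x, x ^ n ∂ν = ∫ x, x ^ n ∂μ := by
    intro n
    rcases Nat.eq_zero_or_pos n with rfl | hn
    · simp
    · rw [hνm n hn, hm]
  have hb : ∀ n : ℕ, ∫ x, x ^ n ∂μ ≤ C ^ n * (n.factorial : ℝ) ^ 2 := by
    intro n
    induction n with
    | zero => simp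
    | succ k ih =>
      have := hg k
      rw [hm, hm] at this
      refine this.trans ((mul_le_mul_of_nonneg_left ih (by positivity)).trans_eq ?_)
      rw [Nat.factorial_succ]; push_cast; ring
  obtain ⟨t, ht, htC⟩ : ∃ t : ℝ, 0 < t ∧ t ^ 2 * C ≤ 1 / 4 := by
    refine ⟨√(1 / (4 * C)), by positivity, ?_⟩
    rw [Real.sq_sqrt (by positivity)]
    apply le_of_eq; field_simp
  have h1 := qgSym_zero_mem μ t ht (qg_integrable_cosh μ hμsupp hint C hC hb t htC)
  have h2 := qgSym_zero_mem ν t ht (qg_integrable_cosh ν hνsupp hνint' C hC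
    (fun n => by rw [heq]; exact hb n) t htC)
  have h3 : qgSym ν = qgSym μ := by
    refine qg_ext_of_moments _ _ h2 h1 fun n => ?_
    rw [qgSym_moment ν hνsupp h2, qgSym_moment μ hμsupp h1, heq]
  have h4 : ν + ν = μ + μ := by
    rw [← qgSym_map ν hνsupp, ← qgSym_map μ hμsupp, h3]
  ext s hs
  have h5 : ν s + ν s = μ s + μ s := by
    have := congrArg (fun ρ : Measure ℝ => ρ s) h4
    simpa using this
  rw [← two_mul, ← two_mul] at h5
  exact (ENNReal.mul_right_inj (by norm_num) (by norm_num)).1 h5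
end

section
/- Let Q(x, t) be a real-valued function of x > 0 and t > 0, twice continuously differentiable in x, satisfying: (1) for all sufficiently large t, the function x ↦ Q(x, t) attains its maximum over (0, ∞) at a point x_t with Q''_{xx}(x_t, t) ≠ 0, and there exists a function μ(t) → ∞ as t → ∞ such that sup { |Q''_{xx}(x, t)/Q''_{xx}(x_t, t) − 1| : x > 0, |x − x_t| ≤ μ(t) |Q''_{xx}(x_t, t)|^{−1/2} } → 0 as t → ∞; (2) Q''_{xx}(x, t) < 0 for all x > 0 and t > 0; (3) x_t · √|Q''_{xx}(x_t, t)| → ∞ as t → ∞. Then the integral S(t) := ∫_0^∞ e^{Q(x,t)} dx satisfies S(t) = √(−2π / Q''_{xx}(x_t, t)) · e^{Q(x_t, t)} · (1 + o(1)) as t → ∞; that is, S(t) / (√(−2π/Q''_{xx}(x_t,t)) e^{Q(x_t,t)}) → 1 as t → ∞. -/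
open MeasureTheory Real Filter Topology Set

lemma second_order_mvt (f f' f'' : ℝ → ℝ)
    (hd : ∀ x : ℝ, 0 < x → HasDerivAt f (f' x) x ∧ HasDerivAt f' (f'' x) x)
    (a x : ℝ) (ha : 0 < a) (hx : 0 < x) (h0 : f' a = 0) :
    ∃ η, 0 < η ∧ |η - a| ≤ |x - a| ∧ f x - f a = f'' η / 2 * (x - a) ^ 2 := by
  have hg : ∀ y : ℝ, HasDerivAt (fun y => (y - a) ^ 2) (2 * (y - a)) y := by
    intro y
    have := ((hasDerivAt_id y).sub_const a).pow 2
    have h2 : (fun y => (y - a) ^ 2) = (fun x => x - a) ^ 2 := rfl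
    rw [h2]
    simpa using this
  rcases lt_trichotomy a x with h | h | h
  · obtain ⟨ξ, ⟨h1, h2⟩, h3⟩ := exists_ratio_hasDerivAt_eq_ratio_slope f f' h
      (fun y hy => (hd y (lt_of_lt_of_le ha hy.1)).1.continuousAt.continuousWithinAt)
      (fun y hy => (hd y (ha.trans hy.1)).1)
      (fun y => (y - a) ^ 2) (fun y => 2 * (y - a)) (by fun_prop) (fun y _ => hg y)
    obtain ⟨η, ⟨h4, h5⟩, h6⟩ := exists_hasDerivAt_eq_slope f' f'' h1
      (fun y hy => (hd y (lt_of_lt_of_le ha hy.1)).2.continuousAt.continuousWithinAt)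
      (fun y hy => (hd y (ha.trans hy.1)).2)
    refine ⟨η, by linarith, ?_, ?_⟩
    · rw [abs_of_pos (by linarith), abs_of_pos (by linarith)]; linarith
    · have hne : ξ - a ≠ 0 := by linarith
      rw [h0, sub_zero, eq_div_iff hne] at h6
      rw [← h6] at h3
      apply mul_right_cancel₀ hne
      simp only [sub_self] at h3
      linear_combination -h3 / 2
  · subst h
    exact ⟨a, ha, by simp, by simp⟩
  · obtain ⟨ξ, ⟨h1, h2⟩, h3⟩ := exists_ratio_hasDerivAt_eq_ratio_slope f f' h
      (fun y hy => (hd y (lt_of_lt_of_le hx hy.1)).1.continuousAt.continuousWithinAt)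
      (fun y hy => (hd y (hx.trans hy.1)).1)
      (fun y => (y - a) ^ 2) (fun y => 2 * (y - a)) (by fun_prop) (fun y _ => hg y)
    obtain ⟨η, ⟨h4, h5⟩, h6⟩ := exists_hasDerivAt_eq_slope f' f'' h2
      (fun y hy => (hd y (by linarith [hy.1])).2.continuousAt.continuousWithinAt)
      (fun y hy => (hd y (by linarith [hy.1])).2)
    refine ⟨η, by linarith, ?_, ?_⟩
    · rw [abs_of_neg (by linarith), abs_of_neg (by linarith)]; linarith
    · have hne : a - ξ ≠ 0 := by linarith
      rw [h0, zero_sub, eq_div_iff hne] at h6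
      have h7 : f' ξ = -(f'' η * (a - ξ)) := by linarith
      rw [h7] at h3
      apply mul_right_cancel₀ hne
      simp only [sub_self] at h3
      linear_combination -h3 / 2

lemma concave_of_second (f f' f'' : ℝ → ℝ)
    (hd : ∀ x : ℝ, 0 < x → HasDerivAt f (f' x) x ∧ HasDerivAt f' (f'' x) x)
    (hn : ∀ x : ℝ, 0 < x → f'' x < 0) : ConcaveOn ℝ (Ioi 0) f := by
  apply concaveOn_of_hasDerivWithinAt2_nonpos (f' := f') (f'' := f'') (convex_Ioi 0)
  · exact fun y hy => (hd y hy).1.continuousAt.continuousWithinAt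
  · intro y hy
    rw [interior_Ioi] at hy
    exact (hd y hy).1.hasDerivWithinAt
  · intro y hy
    rw [interior_Ioi] at hy
    exact (hd y hy).2.hasDerivWithinAt
  · intro y hy
    rw [interior_Ioi] at hy
    exact (hn y hy).le

/-- **Laplace (saddle-point) method.** Let `Q x t` be twice continuously differentiable
in `x` on `(0, ∞)`, with derivatives `Q'` and `Q''` in `x`. Suppose:
(1) for all large `t`, `x ↦ Q x t` attains its maximum over `(0, ∞)` at `xt t`, with
`Q'' (xt t) t ≠ 0`, and there is `μ(t) → ∞` such that
`Q'' x t / Q'' (xt t) t → 1` uniformly for `|x - xt t| ≤ μ(t) |Q'' (xt t) t|^{-1/2}`;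
(2) `Q'' x t < 0` for all `x > 0`, `t > 0`;
(3) `xt t * √|Q'' (xt t) t| → ∞`.
Then `S(t) = ∫_0^∞ e^{Q(x,t)} dx` satisfies
`S(t) = √(-2π / Q''(x_t,t)) e^{Q(x_t,t)} (1 + o(1))` as `t → ∞`. -/
theorem laplace_saddle_point_method
    (Q Q' Q'' : ℝ → ℝ → ℝ) (xt : ℝ → ℝ) (μ : ℝ → ℝ)
    (hderiv : ∀ t : ℝ, 0 < t → ∀ x : ℝ, 0 < x →
      HasDerivAt (fun y => Q y t) (Q' x t) x ∧
      HasDerivAt (fun y => Q' y t) (Q'' x t) x)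
    (hcont : ∀ t : ℝ, 0 < t → ContinuousOn (fun x => Q'' x t) (Set.Ioi 0))
    (hmax : ∀ᶠ t in atTop, 0 < xt t ∧
      IsMaxOn (fun x => Q x t) (Set.Ioi 0) (xt t) ∧ Q'' (xt t) t ≠ 0)
    (hμ : Tendsto μ atTop atTop)
    (huniform : ∀ ε : ℝ, 0 < ε → ∀ᶠ t in atTop, ∀ x : ℝ, 0 < x →
      |x - xt t| ≤ μ t * |Q'' (xt t) t| ^ (-(1 : ℝ) / 2) →
      |Q'' x t / Q'' (xt t) t - 1| ≤ ε)
    (hconcave : ∀ t : ℝ, 0 < t → ∀ x : ℝ, 0 < x → Q'' x t < 0)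
    (hxt : Tendsto (fun t => xt t * Real.sqrt |Q'' (xt t) t|) atTop atTop)
    (hint : ∀ᶠ t in atTop,
      IntegrableOn (fun x => Real.exp (Q x t)) (Set.Ioi (0 : ℝ))) :
    Tendsto
      (fun t : ℝ =>
        (∫ x in Set.Ioi (0 : ℝ), Real.exp (Q x t)) /
          (Real.sqrt (-(2 * Real.pi) / Q'' (xt t) t) * Real.exp (Q (xt t) t)))
      atTop (𝓝 1) := by
  set σ : ℝ → ℝ := fun t => √|Q'' (xt t) t| with hσ
  set F : ℝ → ℝ → ℝ := fun t => (Ioi (0 : ℝ)).indicator (fun x => Real.exp (Q x t)) with hF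
  set g : ℝ → ℝ → ℝ := fun t y => Real.exp (-Q (xt t) t) * F t (xt t + y / σ t) with hg
  have hσpos : ∀ᶠ t in atTop, 0 < σ t := by
    filter_upwards [hmax] with t ht
    exact Real.sqrt_pos.2 (abs_pos.2 ht.2.2)
  -- basic second order expansion in rescaled coordinates
  have key : ∀ ε : ℝ, 0 < ε → ∀ᶠ t in atTop, ∀ y : ℝ, 0 < xt t + y / σ t → |y| ≤ μ t →
      |Q (xt t + y / σ t) t - Q (xt t) t + y ^ 2 / 2| ≤ ε * (y ^ 2 / 2) := by
    intro ε hε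
    filter_upwards [hmax, hσpos, huniform ε hε, eventually_gt_atTop 0] with t hm hs hu ht y hy hyμ
    obtain ⟨hx0, hmx, hq⟩ := hm
    have hq' : Q'' (xt t) t < 0 := hconcave t ht _ hx0
    have hs2 : σ t ^ 2 = - Q'' (xt t) t := by
      simp only [hσ]
      rw [Real.sq_sqrt (abs_nonneg _), abs_of_neg hq']
    have hQ0 : Q' (xt t) t = 0 :=
      (hmx.isLocalMax (Ioi_mem_nhds hx0)).hasDerivAt_eq_zero (hderiv t ht _ hx0).1
    obtain ⟨η, hη, hd, he⟩ := second_order_mvt (fun x => Q x t) (fun x => Q' x t)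
      (fun x => Q'' x t) (hderiv t ht) (xt t) _ hx0 hy hQ0
    have hp : |Q'' (xt t) t| ^ (-(1 : ℝ) / 2) = 1 / σ t := by
      simp only [hσ]
      rw [Real.sqrt_eq_rpow, neg_div, Real.rpow_neg (abs_nonneg _), one_div, one_div]
    have hu1 := hu η hη (by
      rw [hp]
      refine hd.trans ?_
      rw [add_sub_cancel_left, abs_div, abs_of_pos hs, mul_one_div]
      gcongr)
    simp only [add_sub_cancel_left] at he
    have : Q (xt t + y / σ t) t - Q (xt t) t + y ^ 2 / 2
        = -((Q'' η t / Q'' (xt t) t - 1) * (y ^ 2 / 2)) := by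
      rw [he, div_pow, hs2]
      field_simp
      ring
    rw [this, abs_neg, abs_mul, abs_of_nonneg (by positivity : 0 ≤ y ^ 2 / 2)]
    gcongr
  have hgval : ∀ t y, 0 < xt t + y / σ t →
      g t y = Real.exp (Q (xt t + y / σ t) t - Q (xt t) t) := by
    intro t y h
    simp only [hg, hF]
    rw [indicator_of_mem (show xt t + y / σ t ∈ Ioi (0 : ℝ) from h), ← Real.exp_add]
    congr 1; ring
  have hgzero : ∀ t y, ¬ 0 < xt t + y / σ t → g t y = 0 := by
    intro t y h
    simp only [hg, hF]
    rw [indicator_of_notMem (show xt t + y / σ t ∉ Ioi (0 : ℝ) from h), mul_zero]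
  have hFint : ∀ᶠ t in atTop, Integrable (F t) := by
    filter_upwards [hint] with t ht
    exact (integrable_indicator_iff measurableSet_Ioi).2 ht
  -- domination
  have hbound : ∀ᶠ t in atTop, ∀ y : ℝ, g t y ≤ Real.exp (1 / 4) * Real.exp (-(1 / 4) * |y|) := by
    filter_upwards [hmax, hσpos, key (1 / 2) (by norm_num), eventually_gt_atTop 0,
      hμ.eventually_ge_atTop 1] with t hm hs hk ht hμ1 y
    obtain ⟨hx0, hmx, hq⟩ := hm
    by_cases hy : 0 < xt t + y / σ t
    swap
    · rw [hgzero t y hy]; positivity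
    rw [hgval t y hy, ← Real.exp_add]
    apply Real.exp_le_exp.2
    rcases le_or_gt |y| 1 with h1 | h1
    · have : Q (xt t + y / σ t) t ≤ Q (xt t) t := hmx hy
      linarith
    · have hcc := concave_of_second (fun x => Q x t) (fun x => Q' x t)
        (fun x => Q'' x t) (hderiv t ht) (hconcave t ht)
      have hy0 : 0 < |y| := by linarith
      have hs1 : |y|⁻¹ ≤ 1 := inv_le_one_of_one_le₀ h1.le
      have hc := hcc.2 (show xt t ∈ Ioi (0 : ℝ) from hx0)
        (show xt t + y / σ t ∈ Ioi (0 : ℝ) from hy)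
        (show 0 ≤ 1 - |y|⁻¹ by linarith) (show 0 ≤ |y|⁻¹ by positivity) (by ring)
      have hpe : (1 - |y|⁻¹) • xt t + |y|⁻¹ • (xt t + y / σ t)
          = xt t + (y / |y|) / σ t := by
        simp only [smul_eq_mul]; field_simp; ring
      have hpm := hcc.1 (show xt t ∈ Ioi (0 : ℝ) from hx0)
        (show xt t + y / σ t ∈ Ioi (0 : ℝ) from hy)
        (show 0 ≤ 1 - |y|⁻¹ by linarith) (show 0 ≤ |y|⁻¹ by positivity) (by ring)
      rw [hpe] at hc hpm
      have ha1 : |(y / (|y|))| = 1 := by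
        rw [abs_div, abs_abs, div_self hy0.ne']
      have hk1 := hk (y / |y|) hpm (by rw [ha1]; exact hμ1)
      have hsq : (y / |y|) ^ 2 = 1 := by rw [← sq_abs, ha1, one_pow]
      rw [hsq] at hk1
      have hk2 := (abs_le.1 hk1).2
      simp only [smul_eq_mul] at hc
      have h5 : |y|⁻¹ * (Q (xt t + y / σ t) t - Q (xt t) t) ≤ -(1 / 4) := by linarith
      have h6 := mul_le_mul_of_nonneg_left h5 hy0.le
      rw [mul_inv_cancel_left₀ hy0.ne'] at h6
      linarith
  have hbint : Integrable (fun y : ℝ => Real.exp (1 / 4) * Real.exp (-(1 / 4) * |y|)) := by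
    apply Integrable.const_mul
    rw [← integrableOn_univ, ← Iic_union_Ioi (a := (0 : ℝ))]
    apply IntegrableOn.union
    · refine (integrableOn_exp_mul_Iic (show (0 : ℝ) < 1 / 4 by norm_num) 0).congr_fun ?_
        measurableSet_Iic
      intro y hy
      simp only [abs_of_nonpos (mem_Iic.1 hy)]
      congr 1; ring
    · refine (exp_neg_integrableOn_Ioi 0 (show (0 : ℝ) < 1 / 4 by norm_num)).congr_fun ?_
        measurableSet_Ioi
      intro y hy
      simp only [abs_of_pos (mem_Ioi.1 hy)]
  -- pointwise limit
  have hlim : ∀ y : ℝ, Tendsto (fun t => g t y) atTop (𝓝 (Real.exp (-(1 / 2) * y ^ 2))) := by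
    intro y
    have hpos : ∀ᶠ t in atTop, 0 < xt t + y / σ t := by
      filter_upwards [hσpos, hxt.eventually_gt_atTop (-y)] with t hs h
      have : xt t + y / σ t = (xt t * σ t + y) / σ t := by field_simp
      rw [this]
      apply div_pos _ hs
      simp only [hσ]; linarith
    have h1 : Tendsto (fun t => Q (xt t + y / σ t) t - Q (xt t) t) atTop
        (𝓝 (-(1 / 2) * y ^ 2)) := by
      rw [Metric.tendsto_nhds]
      intro ε hε
      have hδ : 0 < ε / (y ^ 2 + 1) := by positivity
      filter_upwards [key _ hδ, hpos, hμ.eventually_ge_atTop |y|] with t hk hp hm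
      rw [Real.dist_eq]
      have h := hk y hp hm
      have e : Q (xt t + y / σ t) t - Q (xt t) t - -(1 / 2) * y ^ 2
        = Q (xt t + y / σ t) t - Q (xt t) t + y ^ 2 / 2 := by ring
      rw [e]
      refine h.trans_lt ?_
      rw [div_mul_eq_mul_div, div_lt_iff₀ (by positivity)]
      nlinarith [sq_nonneg y]
    refine ((Real.continuous_exp.tendsto _).comp h1).congr' ?_
    filter_upwards [hpos] with t ht
    exact (hgval t y ht).symm
  have hDCT : Tendsto (fun t => ∫ y, g t y) atTop
      (𝓝 (∫ y : ℝ, Real.exp (-(1 / 2) * y ^ 2))) := by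
    apply tendsto_integral_filter_of_dominated_convergence _ _ _ hbint
    · exact Eventually.of_forall hlim
    · filter_upwards [hFint, hσpos] with t hi hs
      exact (((hi.comp_add_left (xt t)).comp_div hs.ne').const_mul _).aestronglyMeasurable
    · filter_upwards [hbound] with t hb
      refine Eventually.of_forall fun y => ?_
      have : 0 ≤ g t y := by
        simp only [hg, hF]
        exact mul_nonneg (Real.exp_pos _).le
          (indicator_nonneg (fun _ _ => (Real.exp_pos _).le) _)
      rw [Real.norm_of_nonneg this]
      exact hb y
  rw [integral_gaussian] at hDCT
  have hpi : π / (1 / 2) = 2 * π := by ring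
  rw [hpi] at hDCT
  have hpp : 0 < √(2 * π) := Real.sqrt_pos.2 (by positivity)
  have hfin := hDCT.div_const (√(2 * π))
  rw [div_self hpp.ne'] at hfin
  refine hfin.congr' ?_
  filter_upwards [hmax, hσpos, eventually_gt_atTop 0] with t hm hs ht
  have hq' : Q'' (xt t) t < 0 := hconcave t ht _ hm.1
  have e1 : ∫ y, g t y = Real.exp (-Q (xt t) t) *
      (σ t * ∫ x in Ioi (0 : ℝ), Real.exp (Q x t)) := by
    simp only [hg]
    rw [integral_const_mul]
    rw [Measure.integral_comp_div (fun z => F t (xt t + z)) (σ t), abs_of_pos hs,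
      integral_add_left_eq_self (F t) (xt t), smul_eq_mul]
    simp only [hF]
    rw [integral_indicator measurableSet_Ioi]
  have e2 : √(-(2 * π) / Q'' (xt t) t) = √(2 * π) / σ t := by
    simp only [hσ]
    rw [abs_of_neg hq', ← Real.sqrt_div (by positivity), neg_div, div_neg]
  rw [e1, e2, Real.exp_neg]
  have := Real.exp_pos (Q (xt t) t)
  field_simp
end
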